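/- An additive category C is a Krull–Schmidt category if and only if idempotents split in C and the endomorphism ring of every object of C is a semiperfect ring. -/

import Mathlib

open CategoryTheory CategoryTheory.Limits

attribute [local instance] CategoryTheory.Limits.hasBinaryBiproducts_of_finite_biproducts

/-- A ring `R` is *semiperfect* if `R / J(R)` is a semisimple ring (where `J(R)` is the
Jacobson radical of `R`, viewed as a two-sided ideal) and every idempotent of `R / J(R)`
lifts to an idempotent of `R`. -/
def IsSemiperfectRing (R : Type*) [Ring R] : Prop :=
  IsSemisimpleRing ((⊥ : TwoSidedIdeal R).jacobson.ringCon.Quotient) ∧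
    ∀ x : (⊥ : TwoSidedIdeal R).jacobson.ringCon.Quotient, IsIdempotentElem x →
      ∃ e : R, IsIdempotentElem e ∧ (⊥ : TwoSidedIdeal R).jacobson.ringCon.mk' e = x

/-- An additive category is a *Krull–Schmidt category* if every object decomposes as a finite
biproduct of objects whose endomorphism rings are local. -/
def IsKrullSchmidtCategory (C : Type*) [Category C] [Preadditive C]
    [HasFiniteBiproducts C] : Prop :=
  ∀ X : C, ∃ (n : ℕ) (f : Fin n → C),
    Nonempty (X ≅ ⨁ f) ∧ ∀ i : Fin n, IsLocalRing (End (f i))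

section Ring

variable {R S : Type*} [Ring R] [Ring S]

theorem isUnit_of_map_eq_one {π : R →+* S} (hker : ∀ x, π x = 0 → x ∈ Ring.jacobson R) {a : R}
    (ha : π a = 1) : IsUnit a := by
  have key : ∀ b : R, π b = 1 → ∃ z, z * b = 1 ∧ π z = 1 := fun b hb ↦ by
    have hb0 : π (b - 1) = 0 := by simp [hb]
    have hmem := hker _ hb0
    rw [← Ideal.jacobson_bot, Ideal.mem_jacobson_iff] at hmem
    obtain ⟨z, hz⟩ := hmem 1
    have hzb : z * b = 1 := by
      have : z * b - 1 = 0 := by simpa [mul_sub] using hz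
      exact sub_eq_zero.mp this
    exact ⟨z, hzb, by simpa [hb] using congrArg π hzb⟩
  obtain ⟨z, hza, hz⟩ := key a ha
  obtain ⟨w, hwz, -⟩ := key z hz
  have hwa : w = a := left_inv_eq_right_inv hwz hza
  exact ⟨⟨a, z, hwa ▸ hwz, hza⟩, rfl⟩

theorem isUnit_of_isUnit_map {π : R →+* S} (hπ : Function.Surjective π)
    (hker : ∀ x, π x = 0 → x ∈ Ring.jacobson R) {a : R} (ha : IsUnit (π a)) : IsUnit a := by
  obtain ⟨u, hu⟩ := ha
  obtain ⟨b, hb⟩ := hπ ↑u⁻¹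
  have hab : IsUnit (a * b) := isUnit_of_map_eq_one hker (by simp [hb, ← hu])
  have hba : IsUnit (b * a) := isUnit_of_map_eq_one hker (by simp [hb, ← hu])
  obtain ⟨v, hv⟩ := hab
  obtain ⟨w, hw⟩ := hba
  have hr : a * (b * ↑v⁻¹) = 1 := by rw [← mul_assoc, ← hv, Units.mul_inv]
  have hl : ↑w⁻¹ * b * a = 1 := by rw [mul_assoc, ← hw, Units.inv_mul]
  exact isUnit_iff_exists.mpr ⟨_, hr, left_inv_eq_right_inv hl hr ▸ hl⟩

theorem IsIdempotentElem.eq_zero_of_mem_jacobson {e : R} (he : IsIdempotentElem e)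
    (h : e ∈ Ring.jacobson R) : e = 0 := by
  rw [← Ideal.jacobson_bot, Ideal.mem_jacobson_iff] at h
  obtain ⟨z, hz⟩ := h (-1)
  have hz1 : z * (1 - e) = 1 := by
    rw [← sub_eq_zero, ← (Submodule.mem_bot R).mp hz]
    noncomm_ring
  calc e = z * (1 - e) * e := by rw [hz1, one_mul]
    _ = 0 := by rw [mul_assoc, sub_mul, one_mul, he.eq, sub_self, mul_zero]

theorem isConj_of_mul_eq {f h : R} (h₁ : h * f = h) (h₂ : f * h = f) : IsConj f h := by
  have hh : h * h = h := by
    calc h * h = h * f * h := by rw [h₁]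
      _ = h := by rw [mul_assoc, h₂, h₁]
  have hf : f * f = f := by
    calc f * f = f * h * f := by rw [h₂]
      _ = f := by rw [mul_assoc, h₁, h₂]
  refine ⟨⟨1 + (h - f), 1 - (h - f), ?_, ?_⟩, ?_⟩
  · simp [mul_sub, sub_mul, add_mul, h₁, h₂, hh, hf]
  · simp [mul_sub, sub_mul, mul_add, h₁, h₂, hh, hf]
  · simp [SemiconjBy, mul_sub, sub_mul, add_mul, mul_add, h₁, hh, hf]

theorem IsConj.one_sub {a b : R} (h : IsConj a b) : IsConj (1 - a) (1 - b) := by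
  obtain ⟨c, hc⟩ := h
  exact ⟨c, (SemiconjBy.one_right _).sub_right hc⟩

/-- Two idempotents congruent modulo the Jacobson radical are conjugate. -/
theorem isConj_of_map_eq {π : R →+* S} (hker : ∀ x, π x = 0 → x ∈ Ring.jacobson R) {g h : R}
    (hg : IsIdempotentElem g) (hh : IsIdempotentElem h) (hgh : π g = π h) : IsConj h g := by
  have hv : IsUnit (g * h + (1 - g) * (1 - h)) := isUnit_of_map_eq_one hker (by
    have := (hh.map π).eq
    simp [hgh, mul_sub, sub_mul, this])
  obtain ⟨v, hv⟩ := hv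
  refine ⟨v, ?_⟩
  rw [SemiconjBy, hv]
  have hg' := hg.eq
  have hh' := hh.eq
  have hg1 : g * (1 - g) = 0 := by rw [mul_sub, mul_one, hg', sub_self]
  have hh1 : (1 - h) * h = 0 := by rw [sub_mul, one_mul, hh', sub_self]
  rw [add_mul, mul_add, mul_assoc, hh', mul_assoc, hh1, ← mul_assoc, hg', ← mul_assoc, hg1]
  simp

theorem isConj_of_isConj_map {π : R →+* S} (hπ : Function.Surjective π)
    (hker : ∀ x, π x = 0 → x ∈ Ring.jacobson R) {e g : R} (he : IsIdempotentElem e)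
    (hg : IsIdempotentElem g) (h : IsConj (π e) (π g)) : IsConj e g := by
  obtain ⟨c, hc⟩ := h
  obtain ⟨a, ha⟩ := hπ c
  obtain ⟨u, rfl⟩ := isUnit_of_isUnit_map hπ hker (ha ▸ c.isUnit)
  have hconj : IsConj e (u * e * ↑u⁻¹) := ⟨u, by simp [SemiconjBy]⟩
  refine hconj.trans (isConj_of_map_eq hker hg ?_ ?_)
  · simp [IsIdempotentElem, mul_assoc, ← mul_assoc e e, he.eq]
  · rw [SemiconjBy, ← ha] at hc
    rw [map_mul, map_mul, hc, mul_assoc, ← map_mul]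
    simp

theorem exists_isIdempotentElem_map_eq {π : R →+* S} (hπ : Function.Surjective π)
    (hker : ∀ x, π x = 0 → x ∈ Ring.jacobson R) {x : S} {g : R} (hg : IsIdempotentElem g)
    (h : IsConj (π g) x) : ∃ e, IsIdempotentElem e ∧ π e = x := by
  obtain ⟨c, hc⟩ := h
  obtain ⟨a, ha⟩ := hπ c
  obtain ⟨u, rfl⟩ := isUnit_of_isUnit_map hπ hker (ha ▸ c.isUnit)
  refine ⟨u * g * ↑u⁻¹, ?_, ?_⟩
  · simp [IsIdempotentElem, mul_assoc, ← mul_assoc g g, hg.eq]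
  · rw [SemiconjBy, ← ha] at hc
    rw [map_mul, map_mul, hc, mul_assoc, ← map_mul]
    simp

theorem IsIdempotentElem.mem_span_singleton {e x : R} (he : IsIdempotentElem e) :
    x ∈ Ideal.span {e} ↔ x * e = x := by
  rw [Ideal.mem_span_singleton']
  exact ⟨fun ⟨a, ha⟩ ↦ by rw [← ha, mul_assoc, he.eq], fun h ↦ ⟨x, h⟩⟩

/-- If `R = R f ⊕ R g` for idempotents `f` and `g`, then `f` is conjugate to `1 - g`. -/
theorem isConj_one_sub_of_isCompl {f g : R} (hf : IsIdempotentElem f) (hg : IsIdempotentElem g)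
    (h : IsCompl (Ideal.span {f}) (Ideal.span {g})) : IsConj f (1 - g) := by
  obtain ⟨a, ha, k, hk, hak⟩ := Submodule.mem_sup.mp (h.sup_eq_top ▸ Submodule.mem_top (x := (1 : R)))
  rw [hf.mem_span_singleton] at ha
  rw [hg.mem_span_singleton] at hk
  have uniq : ∀ x y : R, x * f = x → y * g = y → x + y = 0 → y = 0 := fun x y hx hy hxy ↦ by
    refine Submodule.disjoint_def.mp h.disjoint y ?_ (hg.mem_span_singleton.mpr hy)
    rw [eq_neg_of_add_eq_zero_right hxy]
    exact neg_mem (hf.mem_span_singleton.mpr hx)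
  have hkf : f * k = 0 := by
    refine uniq (f * a - f) (f * k) ?_ (by rw [mul_assoc, hk]) ?_
    · rw [sub_mul, mul_assoc, ha, hf.eq]
    · rw [sub_add_eq_add_sub, ← mul_add, hak, mul_one, sub_self]
  have hkg : g * k = g := by
    refine (sub_eq_zero.mp (uniq (g * a) (g * k - g) (by rw [mul_assoc, ha]) ?_ ?_))
    · rw [sub_mul, mul_assoc, hk, hg.eq]
    · rw [add_sub, ← mul_add, hak, mul_one, sub_self]
  have hfa : f * a = f := by
    rw [← add_zero (f * a), ← hkf, ← mul_add, hak, mul_one]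
  obtain rfl : k = 1 - a := eq_sub_of_add_eq' hak
  refine (isConj_of_mul_eq ha hfa).trans ?_
  have := (isConj_of_mul_eq (f := g) (h := 1 - a) hk hkg).one_sub
  rw [sub_sub_cancel] at this
  exact this.symm

variable {ι : Type*} [Fintype ι]

theorem CompleteOrthogonalIdempotents.iSup_span_eq_top {e : ι → R}
    (he : CompleteOrthogonalIdempotents e) : ⨆ i, Ideal.span {e i} = ⊤ := by
  rw [Ideal.eq_top_iff_one, ← he.complete]
  exact sum_mem fun i _ ↦ le_iSup (fun i ↦ Ideal.span {e i}) i (Ideal.mem_span_singleton_self _)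

theorem CompleteOrthogonalIdempotents.isSemisimpleRing {e : ι → R}
    (he : CompleteOrthogonalIdempotents e) (hatom : ∀ i, IsAtom (Ideal.span {e i})) :
    IsSemisimpleRing R := by
  refine isSemisimpleModule_of_isSemisimpleModule_submodule' (p := fun i ↦ Ideal.span {e i})
    (fun i ↦ ?_) he.iSup_span_eq_top
  have := isSimpleModule_iff_isAtom.mpr (hatom i)
  infer_instance

theorem OrthogonalIdempotents.span_insert_sum {ι : Type*} [DecidableEq ι] {e : ι → R}
    (he : OrthogonalIdempotents e)
    (i : ι) (A : Finset ι) (hi : i ∉ A) :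
    Ideal.span {∑ j ∈ insert i A, e j} = Ideal.span {e i} ⊔ Ideal.span {∑ j ∈ A, e j} := by
  refine le_antisymm ?_ (sup_le ?_ ?_)
  · rw [Ideal.span_singleton_le_iff_mem, Finset.sum_insert hi]
    exact Submodule.add_mem_sup (Ideal.mem_span_singleton_self _) (Ideal.mem_span_singleton_self _)
  · rw [Ideal.span_singleton_le_iff_mem, he.isIdempotentElem_sum.mem_span_singleton]
    exact he.mul_sum_of_mem (Finset.mem_insert_self i A)
  · rw [Ideal.span_singleton_le_iff_mem, he.isIdempotentElem_sum.mem_span_singleton,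
      Finset.sum_mul]
    exact Finset.sum_congr rfl fun j hj ↦ he.mul_sum_of_mem (Finset.mem_insert_of_mem hj)

/-- If the left ideals `R eᵢ` are minimal, every idempotent is conjugate to a partial sum
of the `eᵢ`. -/
theorem CompleteOrthogonalIdempotents.exists_isConj_sum {e : ι → R}
    (he : CompleteOrthogonalIdempotents e) (hatom : ∀ i, IsAtom (Ideal.span {e i})) {f : R}
    (hf : IsIdempotentElem f) : ∃ A : Finset ι, IsConj f (∑ i ∈ A, e i) := by
  classical
  obtain ⟨A, hA⟩ := (Set.toFinite
    {A : Finset ι | Disjoint (Ideal.span {f}) (Ideal.span {∑ i ∈ A, e i})}).exists_maximal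
      ⟨∅, by simp⟩
  have hcompl : IsCompl (Ideal.span {f}) (Ideal.span {∑ i ∈ A, e i}) := by
    refine ⟨hA.prop, codisjoint_iff.mpr (top_le_iff.mp ?_)⟩
    rw [← he.iSup_span_eq_top]
    refine iSup_le fun i ↦ ?_
    by_cases hi : i ∈ A
    · refine le_sup_of_le_right ?_
      rw [Ideal.span_singleton_le_iff_mem, he.isIdempotentElem_sum.mem_span_singleton]
      exact he.mul_sum_of_mem hi
    · by_contra hle
      have hdisj := (hatom i).not_le_iff_disjoint.mp hle
      refine hi (hA.le_of_ge (y := insert i A) ?_ (Finset.subset_insert i A)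
        (Finset.mem_insert_self i A))
      change Disjoint _ _
      rw [he.span_insert_sum i A hi, sup_comm]
      exact Disjoint.disjoint_sup_right_of_disjoint_sup_left hA.prop hdisj.symm
  refine ⟨Aᶜ, ?_⟩
  rw [eq_sub_of_add_eq ((Finset.sum_compl_add_sum A e).trans he.complete)]
  exact isConj_one_sub_of_isCompl hf he.isIdempotentElem_sum hcompl

/-- If `e R e` is local, then the left ideal generated by `e` modulo the Jacobson radical
is minimal. -/
theorem isAtom_span_map {π : R →+* S} (hπ : Function.Surjective π)
    (hker : ∀ x, π x = 0 ↔ x ∈ Ring.jacobson R) {e : R} (he : IsIdempotentElem e) (he0 : e ≠ 0)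
    (hloc : ∀ a, e ∈ Ideal.span {e * a * e} ∨ e ∈ Ideal.span {e - e * a * e}) :
    IsAtom (Ideal.span {π e}) := by
  refine ⟨fun h ↦ he0 (he.eq_zero_of_mem_jacobson ((hker e).mp (by simpa using h))), ?_⟩
  intro I hI
  by_contra hI0
  obtain ⟨y, hy, hy0⟩ := Submodule.exists_mem_ne_zero_of_ne_bot hI0
  obtain ⟨x, rfl⟩ := hπ y
  have hxe : π (x * e) = π x := by
    rw [map_mul]
    exact (he.map π).mem_span_singleton.mp (hI.le hy)
  have hnot : x * e ∉ Ring.jacobson R := fun h ↦ hy0 (hxe ▸ (hker _).mpr h)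
  rw [← Ideal.jacobson_bot, Ideal.mem_jacobson_iff] at hnot
  push Not at hnot
  obtain ⟨r, hr⟩ := hnot
  refine hI.not_ge ?_
  rw [Ideal.span_singleton_le_iff_mem]
  rcases hloc (-r * x) with h | h
  · obtain ⟨c, hc⟩ := Ideal.mem_span_singleton'.mp h
    rw [← hc]
    have : c * (e * (-r * x) * e) = (c * e * -r) * (x * e) := by noncomm_ring
    rw [this, map_mul, hxe]
    exact I.mul_mem_left _ hy
  · obtain ⟨c, hc⟩ := Ideal.mem_span_singleton'.mp h
    set t := r * (x * e) with ht
    have hte : t * e = t := by rw [ht, mul_assoc, mul_assoc, he.eq]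
    have hc' : c * (e + e * t) = e := by
      rw [show c * (e + e * t) = c * (e - e * (-r * x) * e) by simp only [ht]; noncomm_ring, hc]
    -- `1 - t c e` is a left inverse of `1 + t`
    refine absurd ?_ (hr (1 - t * c * e))
    rw [Ideal.mem_bot]
    have : (1 - t * c * e) * r * (x * e) + (1 - t * c * e) - 1
        = t - t * (c * (e + e * t)) := by simp only [ht]; noncomm_ring
    rw [this, hc', hte, sub_self]

end Ring

section Semiperfect

variable (R : Type*) [Ring R]

theorem mk'_jacobson_eq_zero_iff (x : R) :
    (⊥ : TwoSidedIdeal R).jacobson.ringCon.mk' x = 0 ↔ x ∈ Ring.jacobson R := by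
  rw [← TwoSidedIdeal.mem_ker, TwoSidedIdeal.ker_ringCon_mk', TwoSidedIdeal.mem_jacobson_iff,
    ← Ideal.jacobson_bot, Ideal.mem_jacobson_iff]
  simp only [Submodule.mem_bot, TwoSidedIdeal.mem_bot]

variable {R}

theorem isSemiperfectRing_of_completeOrthogonalIdempotents {ι : Type*} [Fintype ι] {e : ι → R}
    (he : CompleteOrthogonalIdempotents e) (he0 : ∀ i, e i ≠ 0)
    (hloc : ∀ i a, e i ∈ Ideal.span {e i * a * e i} ∨ e i ∈ Ideal.span {e i - e i * a * e i}) :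
    IsSemiperfectRing R := by
  have hπ := RingCon.mk'_surjective (c := (⊥ : TwoSidedIdeal R).jacobson.ringCon)
  have hker := mk'_jacobson_eq_zero_iff R
  have hatom := fun i ↦ isAtom_span_map hπ hker (he.idem i) (he0 i) (hloc i)
  refine ⟨(he.map _).isSemisimpleRing hatom, fun x hx ↦ ?_⟩
  obtain ⟨A, hA⟩ := (he.map _).exists_isConj_sum hatom hx
  refine exists_isIdempotentElem_map_eq hπ (fun x ↦ (hker x).mp)
    (he.isIdempotentElem_sum (s := A)) ?_
  rw [map_sum]
  exact hA.symm

theorem exists_isConj_sum_of_local {ι : Type*} [Fintype ι] {e : ι → R}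
    (he : CompleteOrthogonalIdempotents e) (he0 : ∀ i, e i ≠ 0)
    (hloc : ∀ i a, e i ∈ Ideal.span {e i * a * e i} ∨ e i ∈ Ideal.span {e i - e i * a * e i})
    {f : R} (hf : IsIdempotentElem f) : ∃ A : Finset ι, IsConj f (∑ i ∈ A, e i) := by
  have hπ := RingCon.mk'_surjective (c := (⊥ : TwoSidedIdeal R).jacobson.ringCon)
  have hker := mk'_jacobson_eq_zero_iff R
  obtain ⟨A, hA⟩ := (he.map _).exists_isConj_sum
    (fun i ↦ isAtom_span_map hπ hker (he.idem i) (he0 i) (hloc i))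
    (hf.map (⊥ : TwoSidedIdeal R).jacobson.ringCon.mk')
  refine ⟨A, isConj_of_isConj_map hπ (fun x ↦ (hker x).mp) hf he.isIdempotentElem_sum ?_⟩
  rw [map_sum]
  exact hA

theorem isUnit_of_forall_isIdempotentElem {S : Type*} [Ring S] [IsSemisimpleRing S]
    (h : ∀ e : S, IsIdempotentElem e → e = 0 ∨ e = 1) {a : S} (ha : a ≠ 0) : IsUnit a := by
  have left : ∀ x : S, x ≠ 0 → ∃ y, y * x = 1 := fun x hx ↦ by
    obtain ⟨e, he, hxe⟩ := IsSemisimpleRing.ideal_eq_span_idempotent (Ideal.span {x})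
    rcases h e he with rfl | rfl
    · simp [hx] at hxe
    · exact Ideal.mem_span_singleton'.mp (hxe ▸ Ideal.mem_span_singleton_self 1)
  obtain ⟨b, hb⟩ := left a ha
  have hb0 : b ≠ 0 := by
    rintro rfl
    exact ha (by rw [← one_mul a, ← hb, zero_mul, zero_mul])
  obtain ⟨c, hc⟩ := left b hb0
  exact ⟨⟨a, b, left_inv_eq_right_inv hc hb ▸ hc, hb⟩, rfl⟩

theorem IsSemiperfectRing.exists_isIdempotentElem [Nontrivial R] (h : IsSemiperfectRing R)
    (hloc : ¬ IsLocalRing R) : ∃ e : R, IsIdempotentElem e ∧ e ≠ 0 ∧ e ≠ 1 := by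
  by_contra! H
  have hπ := RingCon.mk'_surjective (c := (⊥ : TwoSidedIdeal R).jacobson.ringCon)
  have hker := fun x ↦ (mk'_jacobson_eq_zero_iff R x).mp
  obtain ⟨_, hlift⟩ := h
  have hidem : ∀ x : (⊥ : TwoSidedIdeal R).jacobson.ringCon.Quotient,
      IsIdempotentElem x → x = 0 ∨ x = 1 := fun x hx ↦ by
    obtain ⟨e, he, rfl⟩ := hlift x hx
    by_cases he0 : e = 0
    · exact .inl (by rw [he0, map_zero])
    · exact .inr (by rw [H e he he0, map_one])
  refine hloc ⟨fun {a b} hab ↦ ?_⟩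
  by_cases ha : (⊥ : TwoSidedIdeal R).jacobson.ringCon.mk' a = 0
  · refine .inr (isUnit_of_map_eq_one hker ?_)
    rw [← map_one (⊥ : TwoSidedIdeal R).jacobson.ringCon.mk', ← hab, map_add, ha, zero_add]
  · exact .inl (isUnit_of_isUnit_map hπ hker (isUnit_of_forall_isIdempotentElem hidem ha))

/-- If `g < e` are idempotents, then `R g < R e` modulo the Jacobson radical. -/
theorem span_map_lt_span_map {S : Type*} [Ring S] {π : R →+* S}
    (hker : ∀ x, π x = 0 → x ∈ Ring.jacobson R) {e g : R} (he : IsIdempotentElem e)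
    (hg : IsIdempotentElem g) (hge : g * e = g) (heg : e * g = g) (hne : g ≠ e) :
    Ideal.span {π g} < Ideal.span {π e} := by
  refine lt_of_le_not_ge ?_ fun hle ↦ hne ?_
  · rw [Ideal.span_singleton_le_iff_mem, (he.map π).mem_span_singleton, ← map_mul, hge]
  · rw [Ideal.span_singleton_le_iff_mem, (hg.map π).mem_span_singleton, ← map_mul, heg] at hle
    have hsub : IsIdempotentElem (e - g) := by
      simp [IsIdempotentElem, mul_sub, sub_mul, hge, heg, he.eq, hg.eq]
    exact (sub_eq_zero.mp (hsub.eq_zero_of_mem_jacobson (hker _ (by rw [map_sub, hle, sub_self])))).symm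

end Semiperfect

section LocalDecomposition

variable {C : Type*} [Category C] [Preadditive C]

/-- An object is a finite biproduct of objects with local endomorphism rings, expressed through
the projections and inclusions. -/
def HasLocalDecomposition (X : C) : Prop :=
  ∃ (ι : Type) (_ : Fintype ι) (f : ι → C) (p : ∀ i, X ⟶ f i) (s : ∀ i, f i ⟶ X),
    (∀ i, s i ≫ p i = 𝟙 _) ∧ (∀ i j, i ≠ j → s i ≫ p j = 0) ∧ ∑ i, p i ≫ s i = 𝟙 X ∧
      ∀ i, IsLocalRing (End (f i))

theorem hasLocalDecomposition_of_isZero {X : C} (h : 𝟙 X = 0) : HasLocalDecomposition X :=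
  ⟨Empty, inferInstance, Empty.elim, fun i ↦ i.elim, fun i ↦ i.elim, fun i ↦ i.elim,
    fun i ↦ i.elim, by simp [h], fun i ↦ i.elim⟩

theorem hasLocalDecomposition_of_isLocalRing {X : C} (h : IsLocalRing (End X)) :
    HasLocalDecomposition X :=
  ⟨Unit, inferInstance, fun _ ↦ X, fun _ ↦ 𝟙 X, fun _ ↦ 𝟙 X, by simp, by simp, by simp,
    fun _ ↦ h⟩

theorem HasLocalDecomposition.of_retracts {X Y Z : C} (hY : HasLocalDecomposition Y)
    (hZ : HasLocalDecomposition Z) {p : X ⟶ Y} {s : Y ⟶ X} {q : X ⟶ Z} {t : Z ⟶ X}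
    (hsp : s ≫ p = 𝟙 Y) (htq : t ≫ q = 𝟙 Z) (hpq : p ≫ s + q ≫ t = 𝟙 X) :
    HasLocalDecomposition X := by
  have hsq : s ≫ q = 0 := by
    have : s ≫ (p ≫ s + q ≫ t) ≫ q = s ≫ q := by rw [hpq, Category.id_comp]
    simpa [reassoc_of% hsp, htq] using this
  have htp : t ≫ p = 0 := by
    have : t ≫ (p ≫ s + q ≫ t) ≫ p = t ≫ p := by rw [hpq, Category.id_comp]
    simpa [reassoc_of% htq, hsp] using this
  obtain ⟨ι, _, f, p', s', h₁, h₂, h₃, h₄⟩ := hY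
  obtain ⟨κ, _, g, q', t', k₁, k₂, k₃, k₄⟩ := hZ
  refine ⟨ι ⊕ κ, inferInstance, Sum.elim f g,
    Sum.rec (fun i ↦ p ≫ p' i) (fun i ↦ q ≫ q' i), Sum.rec (fun i ↦ s' i ≫ s) (fun i ↦ t' i ≫ t),
    ?_, ?_, ?_, ?_⟩
  · rintro (i | i)
    · simp [reassoc_of% hsp, h₁]
    · simp [reassoc_of% htq, k₁]
  · rintro (i | i) (j | j) hij
    · change (s' i ≫ s) ≫ p ≫ p' j = 0
      simp [reassoc_of% hsp, h₂ i j (by simpa using hij)]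
    · change (s' i ≫ s) ≫ q ≫ q' j = 0
      simp [reassoc_of% hsq]
    · change (t' i ≫ t) ≫ p ≫ p' j = 0
      simp [reassoc_of% htp]
    · change (t' i ≫ t) ≫ q ≫ q' j = 0
      simp [reassoc_of% htq, k₂ i j (by simpa using hij)]
  · have e₁ : ∑ i, p ≫ p' i ≫ s' i ≫ s = p ≫ s := by
      rw [← Preadditive.comp_sum]
      simp_rw [← Category.assoc (p' _)]
      rw [← Preadditive.sum_comp, h₃, Category.id_comp]
    have e₂ : ∑ i, q ≫ q' i ≫ t' i ≫ t = q ≫ t := by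
      rw [← Preadditive.comp_sum]
      simp_rw [← Category.assoc (q' _)]
      rw [← Preadditive.sum_comp, k₃, Category.id_comp]
    simp [e₁, e₂, hpq]
  · rintro (i | i)
    · exact h₄ i
    · exact k₄ i

theorem hasLocalDecomposition_of_retract [IsIdempotentComplete C]
    (hC : ∀ X : C, IsSemiperfectRing (End X)) (X : C) (I : Ideal
      ((⊥ : TwoSidedIdeal (End X)).jacobson.ringCon.Quotient)) :
    ∀ {Y : C} (s : Y ⟶ X) (p : X ⟶ Y), s ≫ p = 𝟙 Y →
      Ideal.span {(⊥ : TwoSidedIdeal (End X)).jacobson.ringCon.mk' (p ≫ s : End X)} = I →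
      HasLocalDecomposition Y := by
  have := (hC X).1
  induction I using WellFoundedLT.induction with
  | ind I ih =>
  intro Y s p hsp hI
  by_cases hY0 : 𝟙 Y = 0
  · exact hasLocalDecomposition_of_isZero hY0
  have : Nontrivial (End Y) := ⟨1, 0, hY0⟩
  by_cases hloc : IsLocalRing (End Y)
  · exact hasLocalDecomposition_of_isLocalRing hloc
  obtain ⟨e, he, he0, he1⟩ := (hC Y).exists_isIdempotentElem hloc
  have summand : ∀ {Z : C} (i : Z ⟶ Y) (q : Y ⟶ Z), i ≫ q = 𝟙 Z → q ≫ i ≠ 𝟙 Y →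
      HasLocalDecomposition Z := fun {Z} i q hiq hqi ↦ by
    have hzx : (i ≫ s) ≫ p ≫ q = 𝟙 Z := by simp [reassoc_of% hsp, hiq]
    refine ih _ (hI ▸ span_map_lt_span_map (R := End X) (fun x ↦ (mk'_jacobson_eq_zero_iff _ x).mp)
      (g := ((p ≫ q) ≫ (i ≫ s) : X ⟶ X)) ?_ ?_ ?_ ?_ ?_) (i ≫ s) (p ≫ q) hzx rfl
    · simp [IsIdempotentElem, End.mul_def, reassoc_of% hsp]
    · simp [IsIdempotentElem, End.mul_def, reassoc_of% hsp, reassoc_of% hiq]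
    · simp [End.mul_def, reassoc_of% hsp]
    · simp [End.mul_def, reassoc_of% hsp]
    · intro h
      refine hqi ?_
      have h' : s ≫ ((p ≫ q) ≫ i ≫ s) ≫ p = s ≫ (p ≫ s) ≫ p := congrArg (fun x ↦ s ≫ x ≫ p) h
      simpa [reassoc_of% hsp, hsp] using h'
  obtain ⟨Z, i, q, hiq, hqi⟩ := IsIdempotentComplete.idempotents_split Y e he
  obtain ⟨W, j, r, hjr, hrj⟩ := IsIdempotentComplete.idempotents_split Y (1 - e) he.one_sub
  refine .of_retracts (summand i q hiq (hqi ▸ he1)) (summand j r hjr ?_) hiq hjr ?_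
  · rw [hrj]
    exact fun h ↦ he0 (by simpa using (h : 1 - e = 1))
  · rw [hqi, hrj]
    exact add_sub_cancel e (1 : End Y)

variable [HasFiniteBiproducts C]

theorem isKrullSchmidtCategory_iff_hasLocalDecomposition :
    IsKrullSchmidtCategory C ↔ ∀ X : C, HasLocalDecomposition X := by
  refine forall_congr' fun X ↦ ⟨?_, ?_⟩
  · rintro ⟨n, f, ⟨α⟩, hf⟩
    refine ⟨Fin n, inferInstance, f, fun i ↦ α.hom ≫ biproduct.π f i,
      fun i ↦ biproduct.ι f i ≫ α.inv, ?_, ?_, ?_, hf⟩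
    · simp
    · intro i j hij
      simp [biproduct.ι_π_ne f hij]
    · have : ∑ i, α.hom ≫ (biproduct.π f i ≫ biproduct.ι f i) ≫ α.inv = 𝟙 X := by
        rw [← Preadditive.comp_sum, ← Preadditive.sum_comp, biproduct.total]
        simp
      simpa using this
  · rintro ⟨ι, _, f, p, s, h₁, h₂, h₃, h₄⟩
    refine ⟨Fintype.card ι, f ∘ (Fintype.equivFin ι).symm, ⟨?_⟩, fun i ↦ h₄ _⟩
    refine (?_ : X ≅ ⨁ f) ≪≫
      (biproduct.whiskerEquiv (Fintype.equivFin ι).symm fun _ ↦ Iso.refl _).symm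
    refine ⟨biproduct.lift p, biproduct.desc s, by rw [biproduct.lift_desc, h₃], ?_⟩
    classical
    ext i j
    by_cases hij : i = j
    · subst hij
      simp [h₁]
    · simp [h₂ j i (Ne.symm hij), biproduct.ι_π_ne f (Ne.symm hij)]

/-- The idempotents of `End X` given by a local decomposition of `X`. -/
theorem HasLocalDecomposition.exists_completeOrthogonalIdempotents {X : C}
    (h : HasLocalDecomposition X) :
    ∃ (ι : Type) (_ : Fintype ι) (e : ι → End X), CompleteOrthogonalIdempotents e ∧
      (∀ i, e i ≠ 0) ∧
      (∀ i a, e i ∈ Ideal.span {e i * a * e i} ∨ e i ∈ Ideal.span {e i - e i * a * e i}) ∧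
      ∀ A : Finset ι, ∃ (Y : C) (i : Y ⟶ X) (q : X ⟶ Y), i ≫ q = 𝟙 Y ∧ q ≫ i = ∑ i ∈ A, e i := by
  obtain ⟨ι, _, f, p, s, h₁, h₂, h₃, h₄⟩ := h
  have h₁' := fun i ↦ reassoc_of% (h₁ i)
  refine ⟨ι, inferInstance, fun i ↦ (p i ≫ s i : X ⟶ X), ⟨⟨?_, ?_⟩, h₃⟩, ?_, ?_, ?_⟩
  · intro i
    simp [IsIdempotentElem, End.mul_def, h₁']
  · intro i j hij
    change (p j ≫ s j) ≫ p i ≫ s i = 0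
    simp [reassoc_of% (h₂ j i hij.symm)]
  · intro i hi
    have : s i ≫ (p i ≫ s i) ≫ p i = s i ≫ (0 : X ⟶ X) ≫ p i := congrArg (fun x ↦ s i ≫ x ≫ p i) hi
    have h0 : (1 : End (f i)) = 0 := by simpa [h₁, h₁'] using this
    have := h₄ i
    exact one_ne_zero h0
  · intro i a
    have := h₄ i
    have key : ∀ b : End (f i), IsUnit b →
        (p i ≫ s i : X ⟶ X) ∈ Ideal.span (α := End X) {p i ≫ b ≫ s i} := by
      rintro _ ⟨u, rfl⟩
      refine (Ideal.mem_span_singleton' (α := End X)).mpr ⟨p i ≫ (u⁻¹).1 ≫ s i, ?_⟩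
      have hu : u.1 ≫ (u⁻¹).1 = 𝟙 _ := u.inv_mul
      change (p i ≫ u.1 ≫ s i) ≫ p i ≫ (u⁻¹).1 ≫ s i = p i ≫ s i
      simp [h₁', reassoc_of% hu]
    rcases IsLocalRing.isUnit_or_isUnit_of_add_one
      (add_sub_cancel (End.of (s i ≫ a ≫ p i)) 1) with hb | hb
    · left
      have hcorner : (p i ≫ s i) ≫ a ≫ p i ≫ s i = p i ≫ (s i ≫ a ≫ p i) ≫ s i := by simp
      have hmem := key (s i ≫ a ≫ p i) hb
      rw [← hcorner] at hmem
      exact hmem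
    · right
      have hcorner : p i ≫ s i - (p i ≫ s i) ≫ a ≫ p i ≫ s i
          = p i ≫ (𝟙 (f i) - s i ≫ a ≫ p i) ≫ s i := by simp
      have hmem := key (𝟙 (f i) - s i ≫ a ≫ p i) hb
      rw [← hcorner] at hmem
      exact hmem
  · intro A
    refine ⟨⨁ fun i : A ↦ f i, biproduct.desc fun i ↦ s i, biproduct.lift fun i ↦ p i, ?_, ?_⟩
    · classical
      ext i j
      by_cases hij : i = j
      · subst hij
        simp [h₁]
      · simp [h₂ j i (Subtype.coe_injective.ne (Ne.symm hij)), biproduct.ι_π_ne _ (Ne.symm hij)]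
    · rw [biproduct.lift_desc]
      exact Finset.sum_coe_sort A fun i ↦ p i ≫ s i

end LocalDecomposition

/-- **Theorem (Chen–Ye–Zhang).** An additive category is Krull–Schmidt if and only if
idempotents split in it and the endomorphism ring of every object is semiperfect. -/
theorem krullSchmidt_iff_idempotentComplete_and_semiperfect
    (C : Type*) [Category C] [Preadditive C] [HasFiniteBiproducts C] :
    IsKrullSchmidtCategory C ↔
      (IsIdempotentComplete C ∧ ∀ X : C, IsSemiperfectRing (End X)) := by
  rw [isKrullSchmidtCategory_iff_hasLocalDecomposition]
  refine ⟨fun h ↦ ⟨⟨fun X e he ↦ ?_⟩, fun X ↦ ?_⟩, fun ⟨_, h⟩ X ↦ ?_⟩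
  · obtain ⟨ι, _, g, hg, hg0, hloc, hsplit⟩ := (h X).exists_completeOrthogonalIdempotents
    obtain ⟨A, u, hu⟩ := exists_isConj_sum_of_local hg hg0 hloc (f := (e : End X)) he
    obtain ⟨Y, i, q, hiq, hqi⟩ := hsplit A
    have hu' : e ≫ u.1 = u.1 ≫ ∑ i ∈ A, g i := hu
    have h₁ : u.1 ≫ (u⁻¹).1 = 𝟙 X := u.inv_mul
    have h₂ : (u⁻¹).1 ≫ u.1 = 𝟙 X := u.mul_inv
    refine ⟨Y, i ≫ (u⁻¹).1, u.1 ≫ q, by simp [reassoc_of% h₂, hiq], ?_⟩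
    rw [Category.assoc, reassoc_of% hqi, ← reassoc_of% hu', h₁, Category.comp_id]
  · obtain ⟨ι, _, g, hg, hg0, hloc, -⟩ := (h X).exists_completeOrthogonalIdempotents
    exact isSemiperfectRing_of_completeOrthogonalIdempotents hg hg0 hloc
  · exact hasLocalDecomposition_of_retract h X _ (𝟙 X) (𝟙 X) (Category.id_comp _) rfl
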